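/- arXiv:1512.07762 — 5 statements merged into one kernel-verified Lean document; each statement's English description precedes it below -/
import Mathlib

section
/- Let T > 0, 0 < ℓ < L, γ ≥ 1, let ω₀ ⊂ ℝ² be a bounded measurable set, and let a = (a₁,a₂,a₃) ∈ ℝ³ with d₃ := a₃ − L > 0. Fix any constant K ∈ ℝ and define η₀(x) := (e^{2γK} − e^{γ|x−a|²})/T² for x ∈ ℝ³, and Ω₀(ℓ) := ω₀ × (−ℓ,ℓ). Then for every measurable ρ : ω₀ → [0,1], every α ∈ C¹([−ℓ,ℓ];ℝ) with α(−ℓ) = α(ℓ) = 0, and every s > 0: ∫_{Ω₀(ℓ)} e^{−2sη₀(x)} ρ(x_τ)² α(x₃)² dx ≤ (T²/(d₃ s)) ∫_{Ω₀(ℓ)} e^{−2sη₀(x)} ρ(x_τ)² (α'(x₃))² dx, i.e. ‖e^{−sη₀} ρα‖_{L²(Ω₀(ℓ))} ≤ (T/√(d₃ s)) ‖e^{−sη₀} ρα'‖_{L²(Ω₀(ℓ))}. -/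
open Real Set MeasureTheory

/-- The Carleman weight at time zero, built from `ϑ(x) = |x−a|²`:
`η₀(x) = (e^{2γK} − e^{γ|x−a|²})/T²`. -/
noncomputable def eta0 (γ K T : ℝ) (a : Fin 3 → ℝ) (x : Fin 3 → ℝ) : ℝ :=
  (Real.exp (2*γ*K) - Real.exp (γ * ∑ i, (x i - a i)^2)) / T^2

/-- A weighted Poincaré inequality on an interval: if `w' = -2qw` and `k ≤ q² - q'`, then
`k ∫ w α² ≤ ∫ w α'²` for every `C¹` function `α` vanishing at the end points. -/
theorem weighted_poincare_interval {l r k : ℝ} (hlr : l < r) {w q q' α : ℝ → ℝ}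
    (hw : ∀ t, HasDerivAt w (-2 * q t * w t) t) (hq : ∀ t, HasDerivAt q (q' t) t)
    (hq' : Continuous q') (hw0 : ∀ t, 0 ≤ w t)
    (hk : ∀ t ∈ Ioo l r, k ≤ q t ^ 2 - q' t)
    (hα : ContDiffOn ℝ 1 α (Icc l r)) (hl : α l = 0) (hr : α r = 0) :
    k * ∫ t in Ioo l r, w t * α t ^ 2
      ≤ ∫ t in Ioo l r, w t * derivWithin α (Icc l r) t ^ 2 := by
  set β := derivWithin α (Icc l r) with hβ
  have hwc : Continuous w := continuous_iff_continuousAt.2 fun t => (hw t).continuousAt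
  have hqc : Continuous q := continuous_iff_continuousAt.2 fun t => (hq t).continuousAt
  have hαc : ContinuousOn α (Icc l r) := hα.continuousOn
  have hβc : ContinuousOn β (Icc l r) :=
    hα.continuousOn_derivWithin (uniqueDiffOn_Icc hlr) le_rfl
  have hint : ∀ f : ℝ → ℝ, ContinuousOn f (Icc l r) → IntegrableOn f (Ioo l r) := fun f hf =>
    hf.integrableOn_Icc.mono_set Ioo_subset_Icc_self
  set D : ℝ → ℝ := fun t => q' t * (w t * α t ^ 2) + q t * (-2 * q t * w t * α t ^ 2
    + w t * (2 * α t * β t)) with hD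
  have hDc : ContinuousOn D (Icc l r) := by
    have := hwc.continuousOn (s := Icc l r)
    have := hqc.continuousOn (s := Icc l r)
    have := hq'.continuousOn (s := Icc l r)
    fun_prop
  have hD0 : ∫ t in Ioo l r, D t = 0 := by
    rw [← integral_Ioc_eq_integral_Ioo, ← intervalIntegral.integral_of_le hlr.le,
      intervalIntegral.integral_eq_sub_of_hasDerivAt_of_le hlr.le
        (f := fun t => q t * (w t * α t ^ 2))]
    · simp [hl, hr]
    · have := hwc.continuousOn (s := Icc l r)
      have := hqc.continuousOn (s := Icc l r)
      fun_prop
    · intro t ht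
      have hαt : HasDerivAt α (β t) t :=
        ((hα.differentiableOn one_ne_zero t
          (Ioo_subset_Icc_self ht)).hasDerivWithinAt).hasDerivAt (Icc_mem_nhds ht.1 ht.2)
      refine ((hq t).mul ((hw t).mul (hαt.pow 2))).congr_deriv ?_
      simp [hD]
    · exact hDc.intervalIntegrable_of_Icc hlr.le
  rw [← integral_const_mul, ← sub_zero (∫ t in Ioo l r, w t * β t ^ 2), ← hD0,
    ← integral_sub (hint _ (by fun_prop)) (hint _ hDc)]
  refine setIntegral_mono_on (hint _ (by fun_prop)) (hint _ ((by fun_prop : ContinuousOn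
    (fun t => w t * β t ^ 2) (Icc l r)).sub hDc)) measurableSet_Ioo fun t ht => ?_
  have h1 := mul_nonneg (hw0 t) (sq_nonneg (β t - q t * α t))
  have h2 := mul_le_mul_of_nonneg_right (hk t ht) (mul_nonneg (hw0 t) (sq_nonneg (α t)))
  simp only [hD]
  nlinarith

/-- The one-dimensional inequality for the Carleman weight along the last coordinate, with the
contribution of the remaining coordinates to `|x - a|²` frozen at `c`. -/
theorem carleman_poincare_interval {T ℓ L γ C b c s : ℝ} (hT : 0 < T) (hℓ : 0 < ℓ)
    (hℓL : ℓ < L) (hγ : 1 ≤ γ) (hb : 0 < b - L) (hc : 0 ≤ c) (hs : 0 < s) {α : ℝ → ℝ}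
    (hα : ContDiffOn ℝ 1 α (Icc (-ℓ) ℓ)) (hαneg : α (-ℓ) = 0) (hαpos : α ℓ = 0) :
    ∫ t in Ioo (-ℓ) ℓ,
        Real.exp (-(2 * s * ((C - Real.exp (γ * (c + (t - b) ^ 2))) / T ^ 2))) * α t ^ 2
      ≤ (T ^ 2 / ((b - L) * s)) * ∫ t in Ioo (-ℓ) ℓ,
        Real.exp (-(2 * s * ((C - Real.exp (γ * (c + (t - b) ^ 2))) / T ^ 2))) *
          derivWithin α (Icc (-ℓ) ℓ) t ^ 2 := by
  set E : ℝ → ℝ := fun t => Real.exp (γ * (c + (t - b) ^ 2)) with hE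
  have hEd : ∀ t, HasDerivAt E (E t * (γ * (2 * (t - b)))) t := by
    intro t
    have h : HasDerivAt (fun t => γ * (c + (t - b) ^ 2)) (γ * (2 * (t - b))) t := by
      refine (((((hasDerivAt_id t).sub_const b).pow 2).const_add c).const_mul γ).congr_deriv ?_
      simp
    exact h.exp
  have hEc : Continuous E := by fun_prop
  have key := weighted_poincare_interval (l := -ℓ) (r := ℓ) (k := (b - L) * s / T ^ 2)
    (w := fun t => Real.exp (-(2 * s * ((C - E t) / T ^ 2))))
    (q := fun t => s / T ^ 2 * (2 * γ * (b - t) * E t))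
    (q' := fun t => -(s / T ^ 2 * (2 * γ * E t * (1 + 2 * γ * (b - t) ^ 2))))
    (α := α) (by linarith)
    (by
      intro t
      refine (((((hEd t).const_sub C).div_const (T ^ 2)).const_mul (2 * s)).neg).exp.congr_deriv ?_
      simp only [Pi.neg_apply]
      ring)
    (by
      intro t
      refine (((((hasDerivAt_id t).const_sub b).const_mul (2 * γ)).mul (hEd t)).const_mul
        (s / T ^ 2)).congr_deriv ?_
      simp only [id]
      ring)
    (by fun_prop) (fun t => (Real.exp_pos _).le)
    (by
      intro t ht
      have hE1 : 1 ≤ E t := Real.one_le_exp (by positivity)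
      have hbt : b - L ≤ b - t := by linarith [ht.2]
      have h1 : 1 ≤ γ * E t := one_le_mul_of_one_le_of_one_le hγ hE1
      have h2 : b - L ≤ 1 + 2 * γ * (b - t) ^ 2 := by
        nlinarith [sq_nonneg (b - t - 1), mul_nonneg (sub_nonneg.2 hγ) (sq_nonneg (b - t))]
      have h3 : b - L ≤ 2 * γ * E t * (1 + 2 * γ * (b - t) ^ 2) := by nlinarith
      have h4 := mul_le_mul_of_nonneg_left h3 (by positivity : 0 ≤ s / T ^ 2)
      have h5 := sq_nonneg (s / T ^ 2 * (2 * γ * (b - t) * E t))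
      have h6 : (b - L) * s / T ^ 2 = s / T ^ 2 * (b - L) := by ring
      linarith)
    hα hαneg hαpos
  have hk : 0 < (b - L) * s / T ^ 2 := by positivity
  rw [← inv_div ((b - L) * s) (T ^ 2), ← div_eq_inv_mul, le_div_iff₀' hk]
  exact key

/-- A product of a continuous weight, a bounded measurable function of the second variable and
a function of the first variable continuous on `[l, r]` is integrable over `(l, r) × S` for
bounded `S`. -/
theorem integrable_prod_weight {V : Type*} [NormedAddCommGroup V] [ProperSpace V]
    [MeasurableSpace V] [BorelSpace V] [SecondCountableTopology V] {μ : Measure V} [SFinite μ]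
    [IsFiniteMeasureOnCompacts μ] {l r : ℝ} {S : Set V} (hS : Bornology.IsBounded S)
    (hSm : MeasurableSet S)
    {W : ℝ × V → ℝ} (hW : Continuous W) {ρ : V → ℝ} (hρm : Measurable ρ)
    (hρ : ∀ v, ρ v ∈ Icc (0 : ℝ) 1) {g : ℝ → ℝ} (hg : ContinuousOn g (Icc l r)) :
    Integrable (fun z : ℝ × V => W z * ρ z.2 ^ 2 * g z.1 ^ 2)
      ((volume.restrict (Ioo l r)).prod (μ.restrict S)) := by
  obtain ⟨R, hR⟩ := hS.subset_closedBall 0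
  have hSfin : μ S < ⊤ := (measure_mono hR).trans_lt (isCompact_closedBall _ _).measure_lt_top
  have : IsFiniteMeasure (μ.restrict S) := isFiniteMeasure_restrict.2 hSfin.ne
  have hgm : AEStronglyMeasurable g (volume.restrict (Ioo l r)) :=
    (hg.mono Ioo_subset_Icc_self).aestronglyMeasurable measurableSet_Ioo
  obtain ⟨A, hA⟩ := (isCompact_Icc.prod (isCompact_closedBall (0 : V) R)).exists_bound_of_continuousOn
    (hW.continuousOn (s := Icc l r ×ˢ Metric.closedBall (0 : V) R))
  obtain ⟨B, hB⟩ := isCompact_Icc.exists_bound_of_continuousOn hg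
  refine Integrable.of_bound (C := A * 1 * B ^ 2) ?_ ?_
  · refine (hW.aestronglyMeasurable.mul ?_).mul (hgm.comp_fst.pow 2)
    exact ((hρm.comp measurable_snd).pow_const 2).aestronglyMeasurable
  · rw [Measure.prod_restrict]
    refine ae_restrict_of_forall_mem (measurableSet_Ioo.prod hSm) fun z hz => ?_
    have hz1 := Ioo_subset_Icc_self hz.1
    have h1 := hA z ⟨hz1, hR hz.2⟩
    have h2 := hB z.1 hz1
    have h3 : ‖ρ z.2‖ ≤ 1 := by
      rw [Real.norm_of_nonneg (hρ z.2).1]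
      exact (hρ z.2).2
    have hA0 : 0 ≤ A := (norm_nonneg _).trans h1
    rw [norm_mul, norm_mul, norm_pow, norm_pow]
    gcongr
    exact pow_le_one₀ (norm_nonneg _) h3

/-- Integration over a cylinder in `ℝ³`, with the last coordinate split off. -/
theorem setIntegral_cylinder (ω : Set (ℝ × ℝ)) (I : Set ℝ) (F : (Fin 3 → ℝ) → ℝ) :
    ∫ x in {x : Fin 3 → ℝ | (x 0, x 1) ∈ ω ∧ x 2 ∈ I}, F x
      = ∫ z, F ![z.2 0, z.2 1, z.1] ∂((volume.restrict I).prod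
          (volume.restrict {v : Fin 2 → ℝ | (v 0, v 1) ∈ ω})) := by
  have hmp := (volume_preserving_piFinSuccAbove (fun _ : Fin 3 => ℝ) 2).symm
  have hsymm : ∀ z : ℝ × (Fin 2 → ℝ),
      (MeasurableEquiv.piFinSuccAbove (fun _ : Fin 3 => ℝ) 2).symm z
        = ![z.2 0, z.2 1, z.1] := by
    intro z
    ext i
    fin_cases i <;> rfl
  rw [← hmp.setIntegral_preimage_emb (MeasurableEquiv.measurableEmbedding _),
    Measure.prod_restrict]
  simp only [hsymm]
  congr 2
  ext z
  simp only [mem_preimage, mem_ofPred_eq, hsymm, mem_prod, Matrix.cons_val]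
  exact and_comm

/-- Lemma 2 of the paper: the weighted Poincaré-type inequality
`‖e^{−sη₀} ρα‖²_{L²(Ω₀(ℓ))} ≤ (T²/(d₃ s)) ‖e^{−sη₀} ρα'‖²_{L²(Ω₀(ℓ))}`
for every `s > 0` and every `α ∈ C¹([−ℓ,ℓ])` vanishing at `±ℓ`. -/
theorem stmt2 (T ℓ L γ K : ℝ) (hT : 0 < T) (hℓ : 0 < ℓ) (hℓL : ℓ < L) (hγ : 1 ≤ γ)
    (ω₀ : Set (ℝ × ℝ)) (hω₀meas : MeasurableSet ω₀) (hω₀bd : Bornology.IsBounded ω₀)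
    (a : Fin 3 → ℝ) (hd₃ : 0 < a 2 - L)
    (ρ : ℝ × ℝ → ℝ) (hρmeas : Measurable ρ) (hρ : ∀ p, ρ p ∈ Icc (0:ℝ) 1)
    (α : ℝ → ℝ) (hα : ContDiffOn ℝ 1 α (Icc (-ℓ) ℓ))
    (hαneg : α (-ℓ) = 0) (hαpos : α ℓ = 0)
    (s : ℝ) (hs : 0 < s) :
    (∫ x in {x : Fin 3 → ℝ | (x 0, x 1) ∈ ω₀ ∧ x 2 ∈ Ioo (-ℓ) ℓ},
        Real.exp (-(2*s*eta0 γ K T a x)) * ρ (x 0, x 1)^2 * α (x 2)^2)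
      ≤ (T^2/((a 2 - L)*s)) *
        ∫ x in {x : Fin 3 → ℝ | (x 0, x 1) ∈ ω₀ ∧ x 2 ∈ Ioo (-ℓ) ℓ},
          Real.exp (-(2*s*eta0 γ K T a x)) * ρ (x 0, x 1)^2 *
            (derivWithin α (Icc (-ℓ) ℓ) (x 2))^2 := by
  set S : Set (Fin 2 → ℝ) := {v | (v 0, v 1) ∈ ω₀} with hSdef
  have hSm : MeasurableSet S :=
    (by fun_prop : Measurable fun v : Fin 2 → ℝ => (v 0, v 1)) hω₀meas
  have hSb : Bornology.IsBounded S := by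
    obtain ⟨R, hR⟩ := hω₀bd.subset_closedBall 0
    refine (Metric.isBounded_closedBall (x := (0 : Fin 2 → ℝ)) (r := max R 0)).subset ?_
    intro v hv
    have h := mem_closedBall_zero_iff.1 (hR hv)
    rw [mem_closedBall_zero_iff, pi_norm_le_iff_of_nonneg (le_max_right _ _)]
    intro i
    fin_cases i
    · exact ((le_max_left _ _).trans h).trans (le_max_left _ _)
    · exact ((le_max_right _ _).trans h).trans (le_max_left _ _)
  have hW : Continuous fun z : ℝ × (Fin 2 → ℝ) =>
      Real.exp (-(2 * s * eta0 γ K T a ![z.2 0, z.2 1, z.1])) := by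
    simp only [eta0, Fin.sum_univ_three, Matrix.cons_val]
    fun_prop
  have hρm : Measurable fun v : Fin 2 → ℝ => ρ (v 0, v 1) := by fun_prop
  have hint : ∀ g : ℝ → ℝ, ContinuousOn g (Icc (-ℓ) ℓ) → _ := fun g hg =>
    integrable_prod_weight (μ := volume) hSb hSm hW hρm (fun v => hρ (v 0, v 1)) hg
  have hi₁ := hint α hα.continuousOn
  have hi₂ := hint _ (hα.continuousOn_derivWithin (uniqueDiffOn_Icc (by linarith)) le_rfl)
  rw [setIntegral_cylinder, setIntegral_cylinder]
  simp only [Matrix.cons_val]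
  rw [integral_prod_symm _ hi₁, integral_prod_symm _ hi₂, ← integral_const_mul]
  refine integral_mono hi₁.integral_prod_right (hi₂.integral_prod_right.const_mul _) fun v => ?_
  have h := mul_le_mul_of_nonneg_left
    (carleman_poincare_interval (C := Real.exp (2 * γ * K))
      (c := (v 0 - a 0) ^ 2 + (v 1 - a 1) ^ 2) hT hℓ hℓL hγ hd₃ (by positivity) hs hα hαneg hαpos)
    (sq_nonneg (ρ (v 0, v 1)))
  rw [mul_left_comm, ← integral_const_mul, ← integral_const_mul] at h
  simp only [eta0, Fin.sum_univ_three, Matrix.cons_val]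
  have hcomm : ∀ A B : ℝ, ρ (v 0, v 1) ^ 2 * (A * B) = A * ρ (v 0, v 1) ^ 2 * B :=
    fun _ _ => by ring
  simpa only [hcomm] using h
end

section
/- Let 0 < ℓ < L, T > 0, γ > 0, let ω ⊂ ℝ² be a nonempty bounded open set, and let a = (a_τ, a₃) ∈ ℝ³ with a_τ ∈ ℝ²∖cl(ω) and d₃ := a₃ − L > 0. Let d_τ := dist(a_τ, ω) = inf_{x_τ ∈ ω} |x_τ − a_τ| and assume ω ∩ B(a_τ, d_τ + 4L(L+d₃)/d_τ) ⊊ ω (i.e. ω is not contained in the closed disc of center a_τ and radius d_τ + 4L(L+d₃)/d_τ). Define ϑ(x) := |x − a|², K := sup_{x ∈ ω×(−L,L)} ϑ(x), and η₀(x) := (e^{2γK} − e^{γϑ(x)})/T². Then there exist open sets ω₁ ⊊ ω₀ ⊊ ω, each of positive Lebesgue measure, such that sup_{x ∈ ω₁×(−ℓ,ℓ)} η₀(x) < inf_{x ∈ (ω∖ω₀)×(−ℓ,ℓ)} η₀(x). -/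
open Real Set Metric MeasureTheory

/-- `ϑ(x_τ, x₃) = |x − a|²` for `x = (x_τ, x₃)`, `a = (a_τ, a₃)`. -/
noncomputable def vth (aτ : EuclideanSpace ℝ (Fin 2)) (a₃ : ℝ)
    (p : EuclideanSpace ℝ (Fin 2)) (t : ℝ) : ℝ :=
  dist p aτ ^ 2 + (t - a₃)^2

/-- The Carleman weight at time zero: `η₀(x) = (e^{2γK} − e^{γϑ(x)})/T²`,
with `K = sup_{ω×(−L,L)} ϑ`. -/
noncomputable def eta0' (γ T : ℝ) (aτ : EuclideanSpace ℝ (Fin 2)) (a₃ : ℝ)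
    (K : ℝ) (p : EuclideanSpace ℝ (Fin 2)) (t : ℝ) : ℝ :=
  (Real.exp (2*γ*K) - Real.exp (γ * vth aτ a₃ p t)) / T^2

/-- Lemma 3 of the paper: under condition (c24) there are open
subsets `ω₁ ⊊ ω₀ ⊊ ω` of positive measure with
`sup_{ω₁×(−ℓ,ℓ)} η₀ < inf_{(ω∖ω₀)×(−ℓ,ℓ)} η₀`. -/
theorem stmt3 (ℓ L T γ : ℝ) (hℓ : 0 < ℓ) (hℓL : ℓ < L) (hT : 0 < T) (hγ : 0 < γ)
    (ω : Set (EuclideanSpace ℝ (Fin 2))) (hωne : ω.Nonempty) (hωopen : IsOpen ω)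
    (hωbd : Bornology.IsBounded ω)
    (aτ : EuclideanSpace ℝ (Fin 2)) (haτ : aτ ∉ closure ω)
    (a₃ : ℝ) (hd₃ : 0 < a₃ - L)
    (hc24 : ¬ (ω ⊆ Metric.ball aτ (Metric.infDist aτ ω
        + 4*L*(L + (a₃ - L)) / Metric.infDist aτ ω))) :
    ∃ ω₁ ω₀ : Set (EuclideanSpace ℝ (Fin 2)),
      IsOpen ω₁ ∧ IsOpen ω₀ ∧
      ω₁ ⊆ ω₀ ∧ ω₁ ≠ ω₀ ∧ ω₀ ⊆ ω ∧ ω₀ ≠ ω ∧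
      0 < volume ω₁ ∧ 0 < volume ω₀ ∧
      sSup (Set.image2
          (eta0' γ T aτ a₃ (sSup (Set.image2 (vth aτ a₃) ω (Ioo (-L) L))))
          ω₁ (Ioo (-ℓ) ℓ))
        < sInf (Set.image2
          (eta0' γ T aτ a₃ (sSup (Set.image2 (vth aτ a₃) ω (Ioo (-L) L))))
          (ω \ ω₀) (Ioo (-ℓ) ℓ)) := by
  set d := Metric.infDist aτ ω
  set C := sSup (Set.image2 (vth aτ a₃) ω (Ioo (-L) L))
  have hL : 0 < L := hℓ.trans hℓL
  have ha₃ : 0 < a₃ := by linarith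
  have haL : 0 < a₃ * L := mul_pos ha₃ hL
  have hd0 : 0 < d := (Metric.infDist_pos_iff_notMem_closure hωne).1 haτ
  have hopen (c : ℝ) : IsOpen {p ∈ ω | c < dist p aτ ^ 2} :=
    hωopen.inter (isOpen_lt continuous_const ((continuous_id.dist continuous_const).pow 2))
  obtain ⟨p₀, hp₀ω, hp₀⟩ := Set.not_subset.1 hc24
  have hfar : d ^ 2 + 6 * (a₃ * L) < dist p₀ aτ ^ 2 := by
    have hR : d + 4 * (a₃ * L) / d ≤ dist p₀ aτ := by
      have h := not_lt.1 (fun h => hp₀ (Metric.mem_ball.2 h))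
      rwa [show 4 * L * (L + (a₃ - L)) = 4 * (a₃ * L) by ring] at h
    have hsq : (d + 4 * (a₃ * L) / d) ^ 2
        = d ^ 2 + 8 * (a₃ * L) + (4 * (a₃ * L) / d) ^ 2 := by
      field_simp
      ring
    have hle := pow_le_pow_left₀ (by positivity) hR 2
    nlinarith [sq_nonneg (4 * (a₃ * L) / d)]
  obtain ⟨q, hqω, hq⟩ : ∃ q ∈ ω, dist q aτ ^ 2 < d ^ 2 + a₃ * L := by
    have hlt : d < √(d ^ 2 + a₃ * L) := Real.lt_sqrt_of_sq_lt (by linarith)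
    obtain ⟨q, hqω, hq⟩ := (Metric.infDist_lt_iff hωne).1 hlt
    rw [dist_comm] at hq
    exact ⟨q, hqω, (Real.lt_sqrt dist_nonneg).1 hq⟩
  set ω₀ : Set (EuclideanSpace ℝ (Fin 2)) := {p ∈ ω | d ^ 2 + a₃ * L < dist p aτ ^ 2}
  set F : Set (EuclideanSpace ℝ (Fin 2)) := {p ∈ ω | d ^ 2 + 6 * (a₃ * L) < dist p aτ ^ 2}
  have hp₀ω₀ : p₀ ∈ ω₀ := ⟨hp₀ω, by linarith⟩
  have hqω₀ : q ∉ ω₀ := fun h => hq.not_gt h.2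
  have hsub : F \ {p₀} ⊆ ω₀ := fun p hp => ⟨hp.1.1, by linarith [hp.1.2]⟩
  have hpos : 0 < volume (F \ {p₀}) := by
    rw [measure_sdiff_null (measure_singleton p₀)]
    exact (hopen _).measure_pos volume ⟨p₀, hp₀ω, hfar⟩
  have h0 : (0 : ℝ) ∈ Ioo (-ℓ) ℓ := ⟨by linarith, hℓ⟩
  refine ⟨F \ {p₀}, ω₀, (hopen _).sdiff isClosed_singleton, hopen _, hsub,
    fun h => (h ▸ hp₀ω₀ : p₀ ∈ F \ {p₀}).2 rfl, fun p hp => hp.1,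
    fun h => hqω₀ (h ▸ hqω), hpos, hpos.trans_le (measure_mono hsub), ?_⟩
  calc
    _ ≤ (Real.exp (2 * γ * C)
          - Real.exp (γ * (d ^ 2 + 6 * (a₃ * L) + (a₃ - ℓ) ^ 2))) / T ^ 2 := by
      refine csSup_le ((nonempty_of_measure_ne_zero hpos.ne').image2 ⟨0, h0⟩) ?_
      rintro _ ⟨p, hp, t, ht, rfl⟩
      have hpF := hp.1.2
      have hv : d ^ 2 + 6 * (a₃ * L) + (a₃ - ℓ) ^ 2 ≤ vth aτ a₃ p t := by
        unfold vth
        nlinarith [ht.1, ht.2]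
      unfold eta0'
      gcongr
    _ < (Real.exp (2 * γ * C)
          - Real.exp (γ * (d ^ 2 + a₃ * L + (a₃ + ℓ) ^ 2))) / T ^ 2 := by
      have hlt : d ^ 2 + a₃ * L + (a₃ + ℓ) ^ 2 < d ^ 2 + 6 * (a₃ * L) + (a₃ - ℓ) ^ 2 := by
        nlinarith [mul_lt_mul_of_pos_left hℓL ha₃]
      gcongr
    _ ≤ _ := by
      refine le_csInf (Set.Nonempty.image2 ⟨q, hqω, hqω₀⟩ ⟨0, h0⟩) ?_
      rintro _ ⟨p, hp, t, ht, rfl⟩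
      have hpω₀ : dist p aτ ^ 2 ≤ d ^ 2 + a₃ * L := not_lt.1 fun h => hp.2 ⟨hp.1, h⟩
      have hv : vth aτ a₃ p t ≤ d ^ 2 + a₃ * L + (a₃ + ℓ) ^ 2 := by
        unfold vth
        nlinarith [ht.1, ht.2]
      unfold eta0'
      gcongr
end

section
/- Let θ, θ̃ ∈ C²(ℝ;ℝ) and set α := θ̇ − θ̃', where θ̇ and θ̃' denote the derivatives. Then for every open set Ω ⊂ ℝ³ and every f ∈ C²(Ω;ℂ) one has, pointwise on Ω: H_{θ̃'} f − H_{θ̇} f = α(x₃)(θ̇(x₃)+θ̃'(x₃)) ∂_φ(∂_φ f) + 2α(x₃) ∂₃(∂_φ f) + α'(x₃) ∂_φ f, i.e. (H_{θ̃'} − H_{θ̇}) f = ( α((θ̇+θ̃')∂_φ + 2∂₃) + α' ) ∂_φ f. -/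
open Real Set

/-- Partial derivative `∂_j` of a complex-valued function on `ℝ³`. -/
noncomputable def pd (j : Fin 3) (f : (Fin 3 → ℝ) → ℂ) (x : Fin 3 → ℝ) : ℂ :=
  fderiv ℝ f x (Pi.single j 1)

/-- The angular derivative `∂_φ := x₁∂₂ − x₂∂₁`. -/
noncomputable def dphi (f : (Fin 3 → ℝ) → ℂ) (x : Fin 3 → ℝ) : ℂ :=
  (x 0 : ℂ) * pd 1 f x - (x 1 : ℂ) * pd 0 f x

/-- The transverse Laplacian `Δ_τ := ∂₁² + ∂₂²`. -/
noncomputable def deltaTau (f : (Fin 3 → ℝ) → ℂ) (x : Fin 3 → ℝ) : ℂ :=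
  pd 0 (pd 0 f) x + pd 1 (pd 1 f) x

/-- `(θ̇∂_φ + ∂₃)² u = θ̇²∂_φ(∂_φ u) + θ̇∂_φ(∂₃u) + ∂₃(θ̇∂_φ u) + ∂₃(∂₃u)`. -/
noncomputable def twistSq (b : ℝ → ℝ) (u : (Fin 3 → ℝ) → ℂ) (x : Fin 3 → ℝ) : ℂ :=
  (b (x 2) : ℂ)^2 * dphi (dphi u) x + (b (x 2) : ℂ) * dphi (pd 2 u) x
    + pd 2 (fun y => (b (y 2) : ℂ) * dphi u y) x + pd 2 (pd 2 u) x

/-- The twisted Laplacian `H_{θ̇} u := −Δ_τ u − (θ̇∂_φ + ∂₃)² u`. -/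
noncomputable def Hop (b : ℝ → ℝ) (u : (Fin 3 → ℝ) → ℂ) (x : Fin 3 → ℝ) : ℂ :=
  - deltaTau u x - twistSq b u x

theorem pd_mul {g h : (Fin 3 → ℝ) → ℂ} {x : Fin 3 → ℝ} (j : Fin 3)
    (hg : DifferentiableAt ℝ g x) (hh : DifferentiableAt ℝ h x) :
    pd j (fun y => g y * h y) x = g x * pd j h x + pd j g x * h x := by
  unfold pd
  rw [fderiv_fun_mul hg hh]
  simp [mul_comm]

theorem pd_sub {g h : (Fin 3 → ℝ) → ℂ} {x : Fin 3 → ℝ} (j : Fin 3)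
    (hg : DifferentiableAt ℝ g x) (hh : DifferentiableAt ℝ h x) :
    pd j (fun y => g y - h y) x = pd j g x - pd j h x := by
  unfold pd
  rw [fderiv_fun_sub hg hh]
  simp

theorem hasFDerivAt_ofReal_comp_apply {b : ℝ → ℝ} {x : Fin 3 → ℝ} (k : Fin 3)
    (hb : DifferentiableAt ℝ b (x k)) :
    HasFDerivAt (fun y : Fin 3 → ℝ => (b (y k) : ℂ))
      (Complex.ofRealCLM.comp (deriv b (x k) • ContinuousLinearMap.proj k)) x :=
  Complex.ofRealCLM.hasFDerivAt.comp x
    (hb.hasDerivAt.comp_hasFDerivAt x (hasFDerivAt_apply k x))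

theorem pd_ofReal_comp_apply {b : ℝ → ℝ} {x : Fin 3 → ℝ} (j k : Fin 3)
    (hb : DifferentiableAt ℝ b (x k)) :
    pd j (fun y => (b (y k) : ℂ)) x = if k = j then ((deriv b (x k) : ℝ) : ℂ) else 0 := by
  unfold pd
  rw [(hasFDerivAt_ofReal_comp_apply k hb).fderiv]
  split_ifs with h <;> simp [h]

theorem differentiableAt_ofReal_apply (k : Fin 3) (x : Fin 3 → ℝ) :
    DifferentiableAt ℝ (fun y : Fin 3 → ℝ => (y k : ℂ)) x :=
  (hasFDerivAt_ofReal_comp_apply k differentiableAt_fun_id).differentiableAt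

theorem differentiableAt_fderiv_of_contDiffAt_two {f : (Fin 3 → ℝ) → ℂ} {x : Fin 3 → ℝ}
    (hf : ContDiffAt ℝ 2 f x) : DifferentiableAt ℝ (fderiv ℝ f) x :=
  (hf.fderiv_right (m := 1) (by norm_num)).differentiableAt (by norm_num)

theorem differentiableAt_pd {f : (Fin 3 → ℝ) → ℂ} {x : Fin 3 → ℝ}
    (hf : ContDiffAt ℝ 2 f x) (j : Fin 3) : DifferentiableAt ℝ (pd j f) x :=
  (differentiableAt_fderiv_of_contDiffAt_two hf).clm_apply (differentiableAt_const _)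

theorem pd_pd {f : (Fin 3 → ℝ) → ℂ} {x : Fin 3 → ℝ} (hf : ContDiffAt ℝ 2 f x) (i j : Fin 3) :
    pd i (pd j f) x = fderiv ℝ (fderiv ℝ f) x (Pi.single i 1) (Pi.single j 1) := by
  change fderiv ℝ (fun y => fderiv ℝ f y (Pi.single j 1)) x (Pi.single i 1) = _
  rw [fderiv_clm_apply (differentiableAt_fderiv_of_contDiffAt_two hf)
    (differentiableAt_const _)]
  simp

theorem pd_comm {f : (Fin 3 → ℝ) → ℂ} {x : Fin 3 → ℝ} (hf : ContDiffAt ℝ 2 f x) (i j : Fin 3) :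
    pd i (pd j f) x = pd j (pd i f) x := by
  rw [pd_pd hf, pd_pd hf]
  exact hf.isSymmSndFDerivAt (by simp) _ _

theorem differentiableAt_dphi {f : (Fin 3 → ℝ) → ℂ} {x : Fin 3 → ℝ}
    (hf : ContDiffAt ℝ 2 f x) : DifferentiableAt ℝ (dphi f) x :=
  ((differentiableAt_ofReal_apply 0 x).mul (differentiableAt_pd hf 1)).sub
    ((differentiableAt_ofReal_apply 1 x).mul (differentiableAt_pd hf 0))

/-- The vertical derivative `∂₃` commutes with the angular derivative `∂_φ`. -/
theorem dphi_pd_two {f : (Fin 3 → ℝ) → ℂ} {x : Fin 3 → ℝ} (hf : ContDiffAt ℝ 2 f x) :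
    dphi (pd 2 f) x = pd 2 (dphi f) x := by
  have hcoord (k : Fin 3) (hk : k ≠ 2) : pd 2 (fun y => (y k : ℂ)) x = 0 := by
    simpa [hk] using pd_ofReal_comp_apply (b := fun s => s) (x := x) 2 k differentiableAt_fun_id
  have h0 := differentiableAt_ofReal_apply 0 x
  have h1 := differentiableAt_ofReal_apply 1 x
  have hd0 := differentiableAt_pd hf 0
  have hd1 := differentiableAt_pd hf 1
  change _ = pd 2 (fun y => (y 0 : ℂ) * pd 1 f y - (y 1 : ℂ) * pd 0 f y) x
  rw [pd_sub 2 (h0.fun_mul hd1) (h1.fun_mul hd0), pd_mul 2 h0 hd1, pd_mul 2 h1 hd0,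
    hcoord 0 (by decide), hcoord 1 (by decide), pd_comm hf 2 0, pd_comm hf 2 1]
  simp [dphi]

theorem twistSq_eq {b : ℝ → ℝ} {f : (Fin 3 → ℝ) → ℂ} {x : Fin 3 → ℝ}
    (hb : DifferentiableAt ℝ b (x 2)) (hf : ContDiffAt ℝ 2 f x) :
    twistSq b f x = (b (x 2) : ℂ) ^ 2 * dphi (dphi f) x + 2 * (b (x 2) : ℂ) * pd 2 (dphi f) x
      + ((deriv b (x 2) : ℝ) : ℂ) * dphi f x + pd 2 (pd 2 f) x := by
  unfold twistSq
  rw [pd_mul 2 (hasFDerivAt_ofReal_comp_apply 2 hb).differentiableAt (differentiableAt_dphi hf),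
    pd_ofReal_comp_apply 2 2 hb, dphi_pd_two hf, if_pos rfl]
  ring

/-- identity (b3star) of the paper: with `α := θ̇ − θ̃'`,
`(H_{θ̃'} − H_{θ̇}) f = α(θ̇+θ̃')∂_φ(∂_φ f) + 2α ∂₃(∂_φ f) + α' ∂_φ f`
pointwise on any open `Ω ⊆ ℝ³` for `f ∈ C²(Ω;ℂ)`. -/
theorem stmt5 (θ θt : ℝ → ℝ) (hθ : ContDiff ℝ 2 θ) (hθt : ContDiff ℝ 2 θt)
    (Ω : Set (Fin 3 → ℝ)) (hΩ : IsOpen Ω)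
    (f : (Fin 3 → ℝ) → ℂ) (hf : ContDiffOn ℝ 2 f Ω) :
    ∀ x ∈ Ω,
      Hop (deriv θt) f x - Hop (deriv θ) f x =
        ((deriv θ (x 2) - deriv θt (x 2)) * (deriv θ (x 2) + deriv θt (x 2)) : ℝ)
            * dphi (dphi f) x
          + (2 * (deriv θ (x 2) - deriv θt (x 2)) : ℝ) * pd 2 (dphi f) x
          + (deriv (fun s => deriv θ s - deriv θt s) (x 2) : ℝ) * dphi f x := by
  intro x hx
  have hfx : ContDiffAt ℝ 2 f x := hf.contDiffAt (hΩ.mem_nhds hx)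
  have hderiv {b : ℝ → ℝ} (hb : ContDiff ℝ 2 b) : DifferentiableAt ℝ (deriv b) (x 2) :=
    hb.differentiable_deriv_two (x 2)
  have ha := hderiv hθ
  have hat := hderiv hθt
  unfold Hop
  rw [twistSq_eq ha hfx, twistSq_eq hat hfx, deriv_fun_sub ha hat]
  push_cast
  ring
end

section
/- Let T > 0, γ ≥ 0, let S be a set and ϑ : S → ℝ a bounded function with ϑ ≥ 0 and ϑ(x) ≥ (2/3) sup_S ϑ for all x ∈ S. Define, for (t,x) ∈ (−T,T)×S, ψ(t,x) := e^{γϑ(x)}/((T−t)(T+t)) and η(t,x) := (e^{2γ sup_S ϑ} − e^{γϑ(x)})/((T−t)(T+t)). Then there is a constant C > 0 depending only on T (one may take C = max(T⁴, 2T, 10T²)) such that for all (t,x) ∈ (−T,T)×S: 0 < ψ(t,x) ≤ C ψ(t,x)³, |∂_t ψ(t,x)| ≤ C ψ(t,x)², and |∂_t² η(t,x)| ≤ C ψ(t,x)³. -/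
open Real Set

/-- First derivative of `c / ((T - τ) * (T + τ))`. -/
theorem hasDerivAt_div_sub_mul_add (c : ℝ) {T t : ℝ} (ht : (T - t) * (T + t) ≠ 0) :
    HasDerivAt (fun τ => c / ((T - τ) * (T + τ))) (c * (2 * t) / ((T - t) * (T + t)) ^ 2) t := by
  have h : HasDerivAt (fun τ : ℝ => (T - τ) * (T + τ)) (-1 * (T + t) + (T - t) * 1) t :=
    ((hasDerivAt_id' t).const_sub T).mul ((hasDerivAt_id' t).const_add T)
  refine ((hasDerivAt_const t c).div h ht).congr_deriv ?_
  ring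

/-- Derivative of `c * (2 * τ) / ((T - τ) * (T + τ)) ^ 2`. -/
theorem hasDerivAt_mul_div_sub_mul_add_sq (c : ℝ) {T t : ℝ} (ht : (T - t) * (T + t) ≠ 0) :
    HasDerivAt (fun τ => c * (2 * τ) / ((T - τ) * (T + τ)) ^ 2)
      (c * (2 * T ^ 2 + 6 * t ^ 2) / ((T - t) * (T + t)) ^ 3) t := by
  have h : HasDerivAt (fun τ : ℝ => (T - τ) * (T + τ)) (-1 * (T + t) + (T - t) * 1) t :=
    ((hasDerivAt_id' t).const_sub T).mul ((hasDerivAt_id' t).const_add T)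
  have h1 : HasDerivAt (fun τ : ℝ => c * (2 * τ)) (c * (2 * 1)) t :=
    ((hasDerivAt_id' t).const_mul 2).const_mul c
  refine (h1.div (h.pow 2) (pow_ne_zero 2 ht)).congr_deriv ?_
  simp only [Pi.pow_apply]
  rw [div_eq_div_iff (pow_ne_zero 2 (pow_ne_zero 2 ht)) (pow_ne_zero 3 ht)]
  push_cast
  ring

/-- Second derivative of `c / ((T - τ) * (T + τ))` on `(-T, T)`. -/
theorem deriv_deriv_div_sub_mul_add (c : ℝ) {T t : ℝ} (ht : t ∈ Ioo (-T) T) :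
    deriv (fun τ => deriv (fun σ => c / ((T - σ) * (T + σ))) τ) t =
      c * (2 * T ^ 2 + 6 * t ^ 2) / ((T - t) * (T + t)) ^ 3 := by
  have hne : ∀ τ ∈ Ioo (-T) T, (T - τ) * (T + τ) ≠ 0 := fun τ hτ =>
    (mul_pos (by linarith [hτ.2]) (by linarith [hτ.1])).ne'
  have heq : (fun τ => deriv (fun σ => c / ((T - σ) * (T + σ))) τ) =ᶠ[nhds t]
      fun τ => c * (2 * τ) / ((T - τ) * (T + τ)) ^ 2 := by
    filter_upwards [isOpen_Ioo.mem_nhds ht] with τ hτ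
    exact (hasDerivAt_div_sub_mul_add c (hne τ hτ)).deriv
  rw [heq.deriv_eq, (hasDerivAt_mul_div_sub_mul_add_sq c (hne t ht)).deriv]

/-- bounds on the Carleman weight functions
`ψ(t,x) = e^{γϑ(x)}/((T−t)(T+t))` and
`η(t,x) = (e^{2γ sup ϑ} − e^{γϑ(x)})/((T−t)(T+t))`:
for some `C > 0` depending only on `T` (one may take
`C = max(T⁴, 2T, 10T²)`), on `(−T,T)×S` one has
`0 < ψ ≤ Cψ³`, `|∂_tψ| ≤ Cψ²` and `|∂_t²η| ≤ Cψ³`. -/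
theorem stmt15 (T γ : ℝ) (hT : 0 < T) (hγ : 0 ≤ γ)
    (S : Type*) (ϑ : S → ℝ) (hbdd : BddAbove (Set.range ϑ))
    (hpos : ∀ x, 0 ≤ ϑ x)
    (hc3 : ∀ x, 2/3 * (⨆ y, ϑ y) ≤ ϑ x) :
    ∃ C : ℝ, 0 < C ∧ C = max (T^4) (max (2*T) (10*T^2)) ∧
      ∀ t ∈ Ioo (-T) T, ∀ x : S,
        (0 < Real.exp (γ * ϑ x) / ((T-t)*(T+t))) ∧
        (Real.exp (γ * ϑ x) / ((T-t)*(T+t))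
          ≤ C * (Real.exp (γ * ϑ x) / ((T-t)*(T+t)))^3) ∧
        (|deriv (fun τ => Real.exp (γ * ϑ x) / ((T-τ)*(T+τ))) t|
          ≤ C * (Real.exp (γ * ϑ x) / ((T-t)*(T+t)))^2) ∧
        (|deriv (fun τ => deriv
              (fun σ => (Real.exp (2*γ*(⨆ y, ϑ y)) - Real.exp (γ * ϑ x))
                / ((T-σ)*(T+σ))) τ) t|
          ≤ C * (Real.exp (γ * ϑ x) / ((T-t)*(T+t)))^3) := by
  refine ⟨_, lt_max_of_lt_left (by positivity), rfl, ?_⟩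
  intro t ht x
  have hP : 0 < (T - t) * (T + t) := mul_pos (by linarith [ht.2]) (by linarith [ht.1])
  have habs : |t| ≤ T := abs_le.2 ⟨ht.1.le, ht.2.le⟩
  have ht2 : t ^ 2 ≤ T ^ 2 := sq_le_sq' ht.1.le ht.2.le
  have ha : 1 ≤ Real.exp (γ * ϑ x) := Real.one_le_exp (mul_nonneg hγ (hpos x))
  have hM : Real.exp (2 * γ * (⨆ y, ϑ y)) ≤ Real.exp (γ * ϑ x) ^ 3 := by
    rw [← Real.exp_nat_mul]
    refine Real.exp_le_exp.2 ?_
    push_cast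
    nlinarith [mul_le_mul_of_nonneg_left (hc3 x) hγ]
  have hM0 := Real.exp_pos (2 * γ * (⨆ y, ϑ y))
  rw [(hasDerivAt_div_sub_mul_add _ hP.ne').deriv, deriv_deriv_div_sub_mul_add _ ht]
  have hPT : (T - t) * (T + t) ≤ T ^ 2 := by nlinarith [sq_nonneg t]
  set a := Real.exp (γ * ϑ x)
  set M := Real.exp (2 * γ * (⨆ y, ϑ y))
  set P := (T - t) * (T + t)
  set C := max (T ^ 4) (max (2 * T) (10 * T ^ 2))
  have hC1 : T ^ 4 ≤ C := le_max_left _ _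
  have hC2 : 2 * T ≤ C := (le_max_left _ _).trans (le_max_right _ _)
  have hC3 : 10 * T ^ 2 ≤ C := (le_max_right _ _).trans (le_max_right _ _)
  have ha3 : a ≤ a ^ 3 := le_self_pow₀ ha (by norm_num)
  have hMa : |M - a| ≤ a ^ 3 := abs_le.2 ⟨by linarith, by linarith⟩
  refine ⟨by positivity, ?_, ?_, ?_⟩
  · have hP2 : P ^ 2 ≤ C := by
      calc P ^ 2 ≤ (T ^ 2) ^ 2 := by gcongr
        _ = T ^ 4 := by ring
        _ ≤ C := hC1
    rw [div_pow, ← mul_div_assoc, div_le_div_iff₀ hP (by positivity)]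
    calc a * P ^ 3 = P ^ 2 * a * P := by ring
      _ ≤ C * a ^ 3 * P := by gcongr
  · rw [div_pow, ← mul_div_assoc, abs_div, abs_of_pos (pow_pos hP 2)]
    gcongr
    rw [abs_mul, abs_mul, abs_of_pos (by positivity : 0 < a), abs_two]
    calc a * (2 * |t|) ≤ a ^ 2 * (2 * T) := by
          gcongr
          exact le_self_pow₀ ha (by norm_num)
      _ ≤ a ^ 2 * C := by gcongr
      _ = C * a ^ 2 := mul_comm _ _
  · rw [div_pow, ← mul_div_assoc, abs_div, abs_of_pos (pow_pos hP 3)]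
    gcongr
    rw [abs_mul, abs_of_nonneg (by positivity : 0 ≤ 2 * T ^ 2 + 6 * t ^ 2), mul_comm C]
    gcongr
    nlinarith [sq_nonneg T]
end

section
/- Let ω ⊂ ℝ² be a bounded open set, L > 0, and a ∈ ℝ³; set ϑ(x) := |x − a|² and, for θ ∈ C²(ℝ;ℝ), 𝔤(x,ξ) := ξᵀ A(θ̇(x₃), x_τ) ξ for x ∈ ℝ³, ξ ∈ ℝ³. Then there exist ε > 0 and c > 0, depending only on ω, L and a, such that for every θ ∈ C²(ℝ;ℝ) with sup|θ̇| + sup|θ̈| ≤ ε, every x ∈ ω×(−L,L) and every ξ ∈ ℝ³: {𝔤, {𝔤, ϑ}}(x,ξ) ≥ c |ξ|², where {f,h}(x,ξ) := Σ_{j=1}^{3} ( ∂_{ξ_j} f · ∂_{x_j} h − ∂_{x_j} f · ∂_{ξ_j} h ) is the Poisson bracket. (At θ̇ ≡ 0 one has {𝔤,{𝔤,ϑ}}(x,ξ) = 8|ξ|², and the bracket is a perturbation of this of size O((sup|θ̇|+sup|θ̈|)|ξ|²).) -/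
open Real Set

/-- The inverse metric matrix `A(β, x_τ)` associated with the twisted Laplacian. -/
def matA (β x₁ x₂ : ℝ) : Matrix (Fin 3) (Fin 3) ℝ :=
  !![1 + β^2*x₂^2, -(β^2*x₁*x₂), -(β*x₂);
     -(β^2*x₁*x₂), 1 + β^2*x₁^2, β*x₁;
     -(β*x₂), β*x₁, 1]

/-- The Poisson bracket
`{F,G}(x,ξ) = Σ_j (∂_{ξ_j}F ∂_{x_j}G − ∂_{x_j}F ∂_{ξ_j}G)` of two symbols on
`ℝ³×ℝ³`. -/
noncomputable def pbr (F G : (Fin 3 → ℝ) → (Fin 3 → ℝ) → ℝ)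
    (x ξ : Fin 3 → ℝ) : ℝ :=
  ∑ j, (fderiv ℝ (F x) ξ (Pi.single j 1)
          * fderiv ℝ (fun y => G y ξ) x (Pi.single j 1)
        - fderiv ℝ (fun y => F y ξ) x (Pi.single j 1)
          * fderiv ℝ (G x) ξ (Pi.single j 1))

/-- The principal symbol `𝔤(x,ξ) = ξᵀ A(θ̇(x₃),x_τ) ξ` of the twisted
Laplacian. -/
noncomputable def gsymb (θ : ℝ → ℝ) (x ξ : Fin 3 → ℝ) : ℝ :=
  ∑ j, ∑ k, ξ j * matA (deriv θ (x 2)) (x 0) (x 1) j k * ξ k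

/-- The weight `ϑ(x) = |x−a|²` viewed as a (ξ-independent) symbol. -/
noncomputable def vthsymb (a : Fin 3 → ℝ) (x _ξ : Fin 3 → ℝ) : ℝ :=
  ∑ i, (x i - a i)^2

lemma gsymb_eq (θ : ℝ → ℝ) (x ξ : Fin 3 → ℝ) :
    gsymb θ x ξ = ξ 0 ^ 2 + ξ 1 ^ 2
      + (ξ 2 + deriv θ (x 2) * (x 0 * ξ 1 - x 1 * ξ 0)) ^ 2 := by
  simp [gsymb, matA, Fin.sum_univ_three]
  ring

lemma hasFDerivAt_coord (i : Fin 3) (x : Fin 3 → ℝ) :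
    HasFDerivAt (fun y : Fin 3 → ℝ => y i) (ContinuousLinearMap.proj (R := ℝ) i) x :=
  (ContinuousLinearMap.proj (R := ℝ) (φ := fun _ : Fin 3 => ℝ) i).hasFDerivAt

lemma hasFDerivAt_deriv_coord {θ : ℝ → ℝ} (hθ : ContDiff ℝ 2 θ) (x : Fin 3 → ℝ) :
    HasFDerivAt (fun y : Fin 3 → ℝ => deriv θ (y 2))
      (deriv (deriv θ) (x 2) • ContinuousLinearMap.proj (R := ℝ) (2 : Fin 3)) x := by
  have hd : Differentiable ℝ (deriv θ) :=
    ((contDiff_succ_iff_deriv (n := 1)).1 (by exact_mod_cast hθ)).2.2.differentiable (by norm_num)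
  exact (hd (x 2)).hasDerivAt.comp_hasFDerivAt x (hasFDerivAt_coord 2 x)

lemma fderiv_gsymb_cotangent (θ : ℝ → ℝ) (x ξ v : Fin 3 → ℝ) :
    fderiv ℝ (gsymb θ x) ξ v = 2 * (ξ 0 * v 0 + ξ 1 * v 1
      + (ξ 2 + deriv θ (x 2) * (x 0 * ξ 1 - x 1 * ξ 0))
        * (v 2 + deriv θ (x 2) * (x 0 * v 1 - x 1 * v 0))) := by
  have h := fun i => hasFDerivAt_coord i ξ
  rw [show gsymb θ x = _ from funext (gsymb_eq θ x)]
  refine (DFunLike.congr_fun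
      ((((h 0).pow 2).add ((h 1).pow 2)).add (((h 2).add ((((h 1).const_mul (x 0)).sub
      ((h 0).const_mul (x 1))).const_mul (deriv θ (x 2)))).pow 2)).fderiv v).trans ?_
  simp
  ring

lemma fderiv_gsymb_base {θ : ℝ → ℝ} (hθ : ContDiff ℝ 2 θ) (x ξ v : Fin 3 → ℝ) :
    fderiv ℝ (fun y => gsymb θ y ξ) x v =
      2 * (ξ 2 + deriv θ (x 2) * (x 0 * ξ 1 - x 1 * ξ 0))
        * (deriv (deriv θ) (x 2) * v 2 * (x 0 * ξ 1 - x 1 * ξ 0)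
          + deriv θ (x 2) * (v 0 * ξ 1 - v 1 * ξ 0)) := by
  have h := fun i => hasFDerivAt_coord i x
  simp only [gsymb_eq]
  refine (DFunLike.congr_fun
      ((((hasFDerivAt_deriv_coord hθ x).mul (((h 0).mul_const (ξ 1)).sub
      ((h 1).mul_const (ξ 0)))).const_add (ξ 2)).pow 2 |>.const_add
        (ξ 0 ^ 2 + ξ 1 ^ 2)).fderiv v).trans ?_
  simp
  ring

lemma pbr_gsymb_vthsymb (θ : ℝ → ℝ) (a x ξ : Fin 3 → ℝ) :
    pbr (gsymb θ) (vthsymb a) x ξ = 4 * ((x 0 - a 0) * ξ 0 + (x 1 - a 1) * ξ 1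
      + (ξ 2 + deriv θ (x 2) * (x 0 * ξ 1 - x 1 * ξ 0))
        * (x 2 - a 2 + deriv θ (x 2) * (a 0 * x 1 - a 1 * x 0))) := by
  have hbase (v : Fin 3 → ℝ) : fderiv ℝ (fun y => vthsymb a y ξ) x v =
      2 * ((x 0 - a 0) * v 0 + (x 1 - a 1) * v 1 + (x 2 - a 2) * v 2) := by
    have h := fun i => hasFDerivAt_coord i x
    simp only [vthsymb, Fin.sum_univ_three]
    refine (DFunLike.congr_fun
        (((((h 0).sub_const (a 0)).pow 2).add (((h 1).sub_const (a 1)).pow 2)).add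
      (((h 2).sub_const (a 2)).pow 2)).fderiv v).trans ?_
    simp
    ring
  have hcot : fderiv ℝ (vthsymb a x) ξ = 0 := by
    rw [show vthsymb a x = fun _ => ∑ i, (x i - a i) ^ 2 from rfl]
    simp
  simp only [pbr, hbase, hcot, fderiv_gsymb_cotangent, Fin.sum_univ_three]
  simp
  ring

/-- The double bracket `{𝔤,{𝔤,ϑ}}` as a polynomial in the values `β = θ̇(x₃)`, `γ = θ̈(x₃)`,
the base point and the covector. -/
def doubleBracket (a : Fin 3 → ℝ) (β γ : ℝ) (x ξ : Fin 3 → ℝ) : ℝ :=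
  let m := x 0 * ξ 1 - x 1 * ξ 0
  let p := ξ 2 + β * m
  let r := a 0 * x 1 - a 1 * x 0
  let q := x 2 - a 2 + β * r
  8 * ((ξ 0 - β * x 1 * p) * (ξ 0 + β * ξ 1 * q - β * a 1 * p)
    + (ξ 1 + β * x 0 * p) * (ξ 1 - β * ξ 0 * q + β * a 0 * p)
    + p * (γ * m * q + p * (1 + γ * r))
    - p * (β * ξ 1 * (x 0 - a 0 - β * x 1 * q) - β * ξ 0 * (x 1 - a 1 + β * x 0 * q)
      + γ * m * q))

lemma pbr_pbr_gsymb_vthsymb {θ : ℝ → ℝ} (hθ : ContDiff ℝ 2 θ) (a x ξ : Fin 3 → ℝ) :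
    pbr (gsymb θ) (pbr (gsymb θ) (vthsymb a)) x ξ =
      doubleBracket a (deriv θ (x 2)) (deriv (deriv θ) (x 2)) x ξ := by
  have hβ := hasFDerivAt_deriv_coord hθ x
  have hbase (v : Fin 3 → ℝ) : fderiv ℝ (fun y => pbr (gsymb θ) (vthsymb a) y ξ) x v =
      4 * (v 0 * ξ 0 + v 1 * ξ 1
        + (deriv (deriv θ) (x 2) * v 2 * (x 0 * ξ 1 - x 1 * ξ 0)
            + deriv θ (x 2) * (v 0 * ξ 1 - v 1 * ξ 0))
          * (x 2 - a 2 + deriv θ (x 2) * (a 0 * x 1 - a 1 * x 0))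
        + (ξ 2 + deriv θ (x 2) * (x 0 * ξ 1 - x 1 * ξ 0))
          * (v 2 + deriv (deriv θ) (x 2) * v 2 * (a 0 * x 1 - a 1 * x 0)
            + deriv θ (x 2) * (a 0 * v 1 - a 1 * v 0))) := by
    have h := fun i => hasFDerivAt_coord i x
    simp only [pbr_gsymb_vthsymb]
    refine (DFunLike.congr_fun
        ((((((h 0).sub_const (a 0)).mul_const (ξ 0)).add
        (((h 1).sub_const (a 1)).mul_const (ξ 1))).add
      (((hβ.mul (((h 0).mul_const (ξ 1)).sub ((h 1).mul_const (ξ 0)))).const_add (ξ 2)).mul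
        (((h 2).sub_const (a 2)).add
          (hβ.mul (((h 1).const_mul (a 0)).sub ((h 0).const_mul (a 1))))))).const_mul 4).fderiv
            v).trans ?_
    simp
    ring
  have hcot (v : Fin 3 → ℝ) : fderiv ℝ (pbr (gsymb θ) (vthsymb a) x) ξ v =
      4 * ((x 0 - a 0) * v 0 + (x 1 - a 1) * v 1
        + (v 2 + deriv θ (x 2) * (x 0 * v 1 - x 1 * v 0))
          * (x 2 - a 2 + deriv θ (x 2) * (a 0 * x 1 - a 1 * x 0))) := by
    have h := fun i => hasFDerivAt_coord i ξ
    rw [show pbr (gsymb θ) (vthsymb a) x = _ from funext (pbr_gsymb_vthsymb θ a x)]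
    refine (DFunLike.congr_fun
        (((((h 0).const_mul (x 0 - a 0)).add ((h 1).const_mul (x 1 - a 1))).add
        (((h 2).add ((((h 1).const_mul (x 0)).sub ((h 0).const_mul (x 1))).const_mul
          (deriv θ (x 2)))).mul_const
            (x 2 - a 2 + deriv θ (x 2) * (a 0 * x 1 - a 1 * x 0)))).const_mul 4).fderiv
            v).trans ?_
    simp
    ring
  rw [pbr]
  simp only [hbase, hcot, fderiv_gsymb_cotangent, fderiv_gsymb_base hθ, Fin.sum_univ_three,
    doubleBracket]
  simp
  ring

lemma doubleBracket_smul (a : Fin 3 → ℝ) (β γ : ℝ) (x : Fin 3 → ℝ) (t : ℝ) (ξ : Fin 3 → ℝ) :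
    doubleBracket a β γ x (t • ξ) = t ^ 2 * doubleBracket a β γ x ξ := by
  simp only [doubleBracket, Pi.smul_apply, smul_eq_mul]
  ring

lemma doubleBracket_zero (a x ξ : Fin 3 → ℝ) :
    doubleBracket a 0 0 x ξ = 8 * ∑ i, ξ i ^ 2 := by
  simp only [doubleBracket, Fin.sum_univ_three]
  ring

lemma sum_sq_pos {ξ : Fin 3 → ℝ} (hξ : ξ ≠ 0) : 0 < ∑ i, ξ i ^ 2 := by
  obtain ⟨i, hi⟩ := Function.ne_iff.1 hξ
  exact Finset.sum_pos' (fun j _ => sq_nonneg (ξ j))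
    ⟨i, Finset.mem_univ i, sq_pos_of_ne_zero hi⟩

/-- On a compact set of base points, the double bracket is coercive in the covector for all
sufficiently small values of the twisting parameters. -/
lemma eventually_le_doubleBracket (a : Fin 3 → ℝ) {K : Set (Fin 3 → ℝ)} (hK : IsCompact K) :
    ∀ᶠ b : ℝ × ℝ in nhds 0, ∀ x ∈ K, ∀ ξ : Fin 3 → ℝ,
      4 * ∑ i, ξ i ^ 2 ≤ doubleBracket a b.1 b.2 x ξ := by
  have hcont : Continuous fun z : (ℝ × ℝ) × (Fin 3 → ℝ) × (Fin 3 → ℝ) =>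
      doubleBracket a z.1.1 z.1.2 z.2.1 z.2.2 - 4 * ∑ i, z.2.2 i ^ 2 := by
    unfold doubleBracket
    fun_prop
  have hsphere : ∀ᶠ b : ℝ × ℝ in nhds 0, ∀ z ∈ K ×ˢ Metric.sphere (0 : Fin 3 → ℝ) 1,
      0 < doubleBracket a b.1 b.2 z.1 z.2 - 4 * ∑ i, z.2 i ^ 2 := by
    refine (hK.prod (isCompact_sphere _ _)).eventually_forall_of_forall_eventually ?_
    rintro ⟨x, ξ⟩ ⟨-, hξ⟩
    refine hcont.continuousAt.eventually_const_lt ?_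
    have hpos := sum_sq_pos (ne_zero_of_mem_unit_sphere ⟨ξ, hξ⟩)
    simp only [Prod.fst_zero, Prod.snd_zero, doubleBracket_zero]
    linarith
  filter_upwards [hsphere] with b hb x hx ξ
  rcases eq_or_ne ξ 0 with rfl | hξ
  · simp [doubleBracket]
  · have hn : ‖ξ‖ ≠ 0 := norm_ne_zero_iff.2 hξ
    have hu := hb (x, ‖ξ‖⁻¹ • ξ) ⟨hx, by simp [norm_smul, hn]⟩
    simp only [doubleBracket_smul, Pi.smul_apply, smul_eq_mul, mul_pow, ← Finset.mul_sum] at hu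
    have hfac : 0 < ‖ξ‖⁻¹ ^ 2 * (doubleBracket a b.1 b.2 x ξ - 4 * ∑ i, ξ i ^ 2) := by
      linarith
    linarith [pos_of_mul_pos_right hfac (sq_nonneg _)]

/-- pseudoconvexity estimate of Section 2.3 of the paper: for
`ϑ(x) = |x−a|²` there are `ε, c > 0` (depending only on `ω`, `L`, `a`) such
that `{𝔤,{𝔤,ϑ}}(x,ξ) ≥ c|ξ|²` on `(ω×(−L,L))×ℝ³` for every twisting `θ` with
`sup|θ̇| + sup|θ̈| ≤ ε`. -/
theorem stmt16 (ω : Set (ℝ × ℝ)) (hωopen : IsOpen ω)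
    (hωbd : Bornology.IsBounded ω) (L : ℝ) (hL : 0 < L) (a : Fin 3 → ℝ) :
    ∃ ε > (0:ℝ), ∃ c > (0:ℝ), ∀ θ : ℝ → ℝ, ContDiff ℝ 2 θ →
      (∀ t, |deriv θ t| + |deriv (deriv θ) t| ≤ ε) →
      ∀ x : Fin 3 → ℝ, (x 0, x 1) ∈ ω → x 2 ∈ Ioo (-L) L →
      ∀ ξ : Fin 3 → ℝ,
        c * ∑ i, (ξ i)^2
          ≤ pbr (gsymb θ) (pbr (gsymb θ) (vthsymb a)) x ξ := by
  obtain ⟨R, hR⟩ := hωbd.subset_closedBall 0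
  obtain ⟨ε, hε, hball⟩ := Metric.eventually_nhds_iff.1
    (eventually_le_doubleBracket a (isCompact_closedBall (0 : Fin 3 → ℝ) (max R L)))
  refine ⟨ε / 2, by positivity, 4, by norm_num, fun θ hθ hsmall x hxω hxL ξ => ?_⟩
  rw [pbr_pbr_gsymb_vthsymb hθ]
  have hs := hsmall (x 2)
  have hβ := abs_nonneg (deriv θ (x 2))
  have hγ := abs_nonneg (deriv (deriv θ) (x 2))
  refine hball (y := (deriv θ (x 2), deriv (deriv θ) (x 2))) ?_ x ?_ ξ
  · rw [dist_zero_right, Prod.norm_def]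
    exact max_lt (by rw [Real.norm_eq_abs]; linarith) (by rw [Real.norm_eq_abs]; linarith)
  · have hx := hR hxω
    rw [mem_closedBall_zero_iff, Prod.norm_def, max_le_iff] at hx
    rw [mem_closedBall_zero_iff, pi_norm_le_iff_of_nonneg (hL.le.trans (le_max_right R L)),
      Fin.forall_fin_succ, Fin.forall_fin_two]
    exact ⟨hx.1.trans (le_max_left R L), hx.2.trans (le_max_left R L),
      (abs_lt.2 hxL).le.trans (le_max_right R L)⟩
end
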